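/- For every integer m ≥ 2 and every integer i with 1 ≤ i ≤ m−1, one has (m+i)/(m+i+1) < c_i(m)/u_i(m) < 1, where c_i(m) = d_i(m)^2 / (d_{i-1}(m) · d_{i+1}(m)) and u_i(m) = (1 + 1/i)(1 + 1/(m−i)). -/

import Mathlib

/-- The Boros-Moll coefficient `d_i(m)`, as a real number:
`d_i(m) = 4^(-m) * sum_{k=0}^m 2^k * C(2m-2k, m-k) * C(m+k, m) * C(k, i)`. -/
noncomputable def d (m i : ℕ) : ℝ :=
  (∑ k ∈ Finset.range (m + 1),
      (2 : ℝ) ^ k * (Nat.choose (2 * m - 2 * k) (m - k) : ℝ) *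
        (Nat.choose (m + k) m : ℝ) * (Nat.choose k i : ℝ)) / 4 ^ m

/-- The coefficient of `(1 + a) ^ k` in `4 ^ m` times the Boros-Moll polynomial in `a`. -/
def borosMollWeight (m k : ℕ) : ℝ :=
  (2 : ℝ) ^ k * (Nat.choose (2 * m - 2 * k) (m - k) : ℝ) * (Nat.choose (m + k) m : ℝ)

theorem borosMollWeight_pos {m k : ℕ} (hk : k ≤ m) : 0 < borosMollWeight m k := by
  have h₁ : 0 < Nat.choose (2 * m - 2 * k) (m - k) := Nat.choose_pos (by omega)
  have h₂ : 0 < Nat.choose (m + k) m := Nat.choose_pos (by omega)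
  unfold borosMollWeight
  positivity

theorem borosMollWeight_succ {m k : ℕ} (hk : k < m) :
    (2 * (m : ℝ) - 2 * k - 1) * (k + 1) * borosMollWeight m (k + 1) =
      ((m : ℝ) - k) * (m + k + 1) * borosMollWeight m k := by
  obtain ⟨n, rfl⟩ : ∃ n, m = k + n + 1 := ⟨m - k - 1, by omega⟩
  have h₁ := Nat.succ_mul_centralBinom_succ n
  have h₂ := Nat.choose_mul_succ_eq (k + n + 1 + k) (k + n + 1)
  rw [show k + n + 1 + k + 1 - (k + n + 1) = k + 1 by omega] at h₂
  unfold Nat.centralBinom at h₁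
  unfold borosMollWeight
  rw [show 2 * (k + n + 1) - 2 * k = 2 * (n + 1) by omega,
    show k + n + 1 - k = n + 1 by omega,
    show 2 * (k + n + 1) - 2 * (k + 1) = 2 * n by omega,
    show k + n + 1 - (k + 1) = n by omega,
    show k + n + 1 + (k + 1) = k + n + 1 + k + 1 by omega, pow_succ]
  generalize Nat.choose (2 * (n + 1)) (n + 1) = a at *
  generalize Nat.choose (2 * n) n = b at *
  generalize Nat.choose (k + n + 1 + k) (k + n + 1) = p at *
  generalize Nat.choose (k + n + 1 + k + 1) (k + n + 1) = q at *
  have h₁' : ((n : ℝ) + 1) * a = 2 * (2 * n + 1) * b := by exact_mod_cast h₁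
  have h₂' : (p : ℝ) * (k + n + 1 + k + 1) = q * (k + 1) := by exact_mod_cast h₂
  push_cast
  linear_combination (-(2 : ℝ) ^ k * p * (2 * k + n + 2)) * h₁' -
    (2 : ℝ) ^ k * 2 * (2 * n + 1) * b * h₂'

theorem cast_choose_succ_mul (n k : ℕ) :
    ((k : ℝ) + 1) * (Nat.choose n (k + 1) : ℝ) = ((n : ℝ) - k) * (Nat.choose n k : ℝ) := by
  rcases le_or_gt k n with h | h
  · have := Nat.choose_succ_right_eq n k
    rw [← Nat.cast_sub h, mul_comm, mul_comm ((n - k : ℕ) : ℝ)]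
    exact_mod_cast this
  · simp [Nat.choose_eq_zero_of_lt h, Nat.choose_eq_zero_of_lt (Nat.lt_succ_of_lt h)]

theorem cast_choose_mul_succ (n k : ℕ) :
    ((n : ℝ) + 1 - k) * (Nat.choose (n + 1) k : ℝ) = ((n : ℝ) + 1) * (Nat.choose n k : ℝ) := by
  rw [show (n : ℝ) + 1 = ((n + 1 : ℕ) : ℝ) by push_cast; rfl, ← cast_choose_succ_mul]
  have := Nat.add_one_mul_choose_eq n k
  rw [mul_comm]
  exact_mod_cast this.symm

theorem d_eq_sum (m i : ℕ) :
    d m i = (∑ k ∈ Finset.range (m + 1), borosMollWeight m k * (Nat.choose k i : ℝ)) / 4 ^ m :=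
  rfl

theorem d_pos {m i : ℕ} (hi : i ≤ m) : 0 < d m i := by
  rw [d_eq_sum]
  refine div_pos (Finset.sum_pos' (fun k hk => ?_) ⟨m, by simp, ?_⟩) (by positivity)
  · have := borosMollWeight_pos (Nat.lt_succ_iff.mp (Finset.mem_range.mp hk))
    positivity
  · have := borosMollWeight_pos (le_refl m)
    have := Nat.choose_pos hi
    positivity

theorem d_succ_self (m : ℕ) : d m (m + 1) = 0 := by
  rw [d_eq_sum, Finset.sum_eq_zero, zero_div]
  intro k hk
  rw [Nat.choose_eq_zero_of_lt (Finset.mem_range.mp hk)]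
  simp

/-- The three-term recurrence of the Boros-Moll coefficients in the lower index. -/
theorem d_recurrence (m j : ℕ) :
    ((m : ℝ) - j) * (m + j + 1) * d m j - (j + 1) * (2 * m + 1) * d m (j + 1) +
      (j + 1) * (j + 2) * d m (j + 2) = 0 := by
  set T : ℕ → ℝ := fun k => borosMollWeight m k *
    (((m : ℝ) - j) * (m + j + 1) * (Nat.choose k j : ℝ) -
      (j + 1) * (2 * m + 1) * (Nat.choose k (j + 1) : ℝ) +
      (j + 1) * (j + 2) * (Nat.choose k (j + 2) : ℝ)) with hT
  have hTk (k : ℕ) : T k = borosMollWeight m k * (Nat.choose k j : ℝ) *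
      (((m : ℝ) - k) * (m + k + 1) - (2 * m - 2 * k + 1) * (k - j)) := by
    have h₁ := cast_choose_succ_mul k j
    have h₂ := cast_choose_succ_mul k (j + 1)
    push_cast at h₂
    simp only [hT]
    linear_combination borosMollWeight m k * ((j + 1) * h₂ + (k - j - 1 - (2 * m + 1)) * h₁)
  have hsum (n : ℕ) (hn : n ≤ m) : ∑ k ∈ Finset.range n, T k =
      borosMollWeight m n * (2 * m - 2 * n + 1) * (n - j) * (Nat.choose n j : ℝ) := by
    induction n with
    | zero => rcases j with _ | j <;> simp
    | succ n ih =>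
      rw [Finset.sum_range_succ, ih (by omega), hTk]
      have h₁ := borosMollWeight_succ (show n < m by omega)
      have h₂ := cast_choose_mul_succ n j
      push_cast
      linear_combination -(Nat.choose n j : ℝ) * h₁ -
        borosMollWeight m (n + 1) * (2 * m - 2 * n - 1) * h₂
  have hzero : ∑ k ∈ Finset.range (m + 1), T k = 0 := by
    rw [Finset.sum_range_succ, hsum m le_rfl, hTk]
    ring
  have hlin : ((m : ℝ) - j) * (m + j + 1) * d m j - (j + 1) * (2 * m + 1) * d m (j + 1) +
      (j + 1) * (j + 2) * d m (j + 2) = (∑ k ∈ Finset.range (m + 1), T k) / 4 ^ m := by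
    simp only [d_eq_sum, mul_div_assoc', ← sub_div, ← add_div, Finset.mul_sum,
      ← Finset.sum_sub_distrib, ← Finset.sum_add_distrib, hT]
    congr 1
    exact Finset.sum_congr rfl fun k _ => by ring
  rw [hlin, hzero, zero_div]

theorem succ_mul_d_succ_lt {m j : ℕ} (hj : j < m) :
    ((j : ℝ) + 1) * d m (j + 1) < (m - j) * d m j := by
  obtain ⟨n, hn⟩ : ∃ n, j + n + 1 = m := ⟨m - j - 1, by omega⟩
  have key : ((j : ℝ) + 2) * d m (j + 2) ≤ (m - (j + 1)) * d m (j + 1) := by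
    induction n generalizing j with
    | zero =>
      obtain rfl : j + 1 = m := by omega
      rw [show j + 2 = j + 1 + 1 by rfl, d_succ_self]
      simp
    | succ n ih =>
      have h := ih (j := j + 1) (by omega) (by omega)
      have hrec := d_recurrence m (j + 1)
      have hp := d_pos (show j + 2 ≤ m by omega)
      have hm : (m : ℝ) = j + n + 2 := by rw [← hn]; push_cast; ring
      rw [show j + 1 + 1 = j + 2 by rfl, show j + 1 + 2 = j + 3 by rfl] at h hrec
      push_cast at h hrec
      have hj0 : (0 : ℝ) ≤ j := j.cast_nonneg
      have hn0 : (0 : ℝ) ≤ n := n.cast_nonneg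
      refine le_of_mul_le_mul_left ?_ (show (0 : ℝ) < m + j + 2 by positivity)
      nlinarith [mul_le_mul_of_nonneg_left h (show (0 : ℝ) ≤ j + 2 by positivity),
        mul_pos (show (0 : ℝ) < j + 2 by positivity) hp]
  have hrec := d_recurrence m j
  have hp := d_pos (show j + 1 ≤ m by omega)
  have hj0 : (0 : ℝ) ≤ j := j.cast_nonneg
  refine lt_of_mul_lt_mul_left ?_ (show (0 : ℝ) ≤ m + j + 1 by positivity)
  nlinarith [mul_le_mul_of_nonneg_left key (show (0 : ℝ) ≤ j + 1 by positivity),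
    mul_pos (show (0 : ℝ) < j + 1 by positivity) hp]

/-- The smaller root `x` of `x * (2 * m + 1 - x) = m ^ 2 - i ^ 2`. -/
noncomputable def ratioBound (m i : ℕ) : ℝ :=
  (2 * m + 1 - √(4 * (i : ℝ) ^ 2 + 4 * m + 1)) / 2

theorem ratioBound_mul (m i : ℕ) :
    ratioBound m i * (2 * m + 1 - ratioBound m i) = (m : ℝ) ^ 2 - i ^ 2 := by
  have h := Real.sq_sqrt (show (0 : ℝ) ≤ 4 * (i : ℝ) ^ 2 + 4 * m + 1 by positivity)
  unfold ratioBound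
  linear_combination (-1 / 4 : ℝ) * h

theorem ratioBound_self (m : ℕ) : ratioBound m m = 0 := by
  unfold ratioBound
  rw [show 4 * (m : ℝ) ^ 2 + 4 * m + 1 = (2 * m + 1) ^ 2 by ring, Real.sqrt_sq (by positivity)]
  simp

theorem ratioBound_le {m i : ℕ} (hi : i ≤ m) : ratioBound m i ≤ m - i := by
  have h : 2 * (i : ℝ) + 1 ≤ √(4 * (i : ℝ) ^ 2 + 4 * m + 1) := by
    have : (i : ℝ) ≤ m := by exact_mod_cast hi
    exact Real.le_sqrt_of_sq_le (by nlinarith)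
  unfold ratioBound
  linarith

theorem ratioBound_step {m j : ℕ} (hj : j < m) :
    ((m : ℝ) + j) * (2 * m + 1 - ratioBound m (j + 1)) <
      (m + j + 1) * (2 * m + 1 - ratioBound m j) := by
  have hjm : (j : ℝ) + 1 ≤ m := by exact_mod_cast hj
  have hj0 : (0 : ℝ) ≤ j := j.cast_nonneg
  have e₀ := Real.sq_sqrt (show (0 : ℝ) ≤ 4 * (j : ℝ) ^ 2 + 4 * m + 1 by positivity)
  have e₁ := Real.sq_sqrt (show (0 : ℝ) ≤ 4 * ((j + 1 : ℕ) : ℝ) ^ 2 + 4 * m + 1 by positivity)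
  have l₀ : 2 * (j : ℝ) + 1 ≤ √(4 * (j : ℝ) ^ 2 + 4 * m + 1) :=
    Real.le_sqrt_of_sq_le (by nlinarith)
  have l₁ : 2 * (j : ℝ) + 3 ≤ √(4 * ((j + 1 : ℕ) : ℝ) ^ 2 + 4 * m + 1) :=
    Real.le_sqrt_of_sq_le (by push_cast; nlinarith)
  unfold ratioBound
  generalize √(4 * (j : ℝ) ^ 2 + 4 * m + 1) = s at *
  generalize √(4 * ((j + 1 : ℕ) : ℝ) ^ 2 + 4 * m + 1) = t at *
  push_cast at e₁
  have hdiff : (t - s) * (t + s) = 4 * (2 * j + 1) := by linear_combination e₁ - e₀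
  have hsum : 4 * (j : ℝ) + 4 ≤ t + s := by linarith
  have hlt : ((m : ℝ) + j + 1) * (t - s) < 2 * m + 1 + t := by
    refine lt_of_mul_lt_mul_right ?_ (show 0 ≤ t + s by linarith)
    calc ((m : ℝ) + j + 1) * (t - s) * (t + s) = (m + j + 1) * (4 * (2 * j + 1)) := by
          rw [mul_assoc, hdiff]
      _ < (2 * m + 2 * j + 4) * (4 * j + 4) := by nlinarith
      _ ≤ (2 * m + 1 + t) * (t + s) :=
          mul_le_mul (by linarith) hsum (by positivity) (by linarith)
  linarith

theorem ratioBound_mul_lt {m j : ℕ} (hj : j < m) :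
    ratioBound m j * d m j < ((j : ℝ) + 1) * d m (j + 1) := by
  have step {j : ℕ} (hj : j < m)
      (h : ratioBound m (j + 1) * d m (j + 1) ≤ ((j : ℝ) + 2) * d m (j + 2)) :
      ratioBound m j * d m j < ((j : ℝ) + 1) * d m (j + 1) := by
    have hrec := d_recurrence m j
    have hy := d_pos (show j + 1 ≤ m by omega)
    have hstep := ratioBound_step hj
    have hroot := ratioBound_mul m j
    have hle := ratioBound_le hj.le
    have hjm : (j : ℝ) + 1 ≤ m := by exact_mod_cast hj
    have hj0 : (0 : ℝ) ≤ j := j.cast_nonneg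
    generalize ratioBound m j = g at *
    generalize ratioBound m (j + 1) = f at *
    generalize d m j = x at *
    generalize d m (j + 1) = y at *
    generalize d m (j + 2) = z at *
    have hg' : 0 < 2 * (m : ℝ) + 1 - g := by linarith
    have hg : 0 < g := pos_of_mul_pos_left (by rw [hroot]; nlinarith) hg'.le
    have hA : g * (2 * m + 1 - f) < ((m : ℝ) - j) * (m + j + 1) := by
      refine lt_of_mul_lt_mul_right ?_ hg'.le
      have := mul_lt_mul_of_pos_left hstep (show (0 : ℝ) < m - j by linarith)
      linear_combination this + (2 * m + 1 - f) * hroot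
    have hx : ((m : ℝ) - j) * (m + j + 1) * x ≤ (j + 1) * y * (2 * m + 1 - f) := by
      linear_combination hrec + ((j : ℝ) + 1) * h
    refine lt_of_mul_lt_mul_left ?_ (show (0 : ℝ) ≤ (m - j) * (m + j + 1) by nlinarith)
    calc ((m : ℝ) - j) * (m + j + 1) * (g * x) = g * (((m : ℝ) - j) * (m + j + 1) * x) := by ring
      _ ≤ g * ((j + 1) * y * (2 * m + 1 - f)) := mul_le_mul_of_nonneg_left hx hg.le
      _ = (g * (2 * m + 1 - f)) * ((j + 1) * y) := by ring
      _ < ((m : ℝ) - j) * (m + j + 1) * ((j + 1) * y) :=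
          mul_lt_mul_of_pos_right hA (by positivity)
  obtain ⟨n, hn⟩ : ∃ n, j + n + 1 = m := ⟨m - j - 1, by omega⟩
  refine step hj ?_
  induction n generalizing j with
  | zero =>
    obtain rfl : j + 1 = m := by omega
    rw [show j + 2 = j + 1 + 1 by rfl, d_succ_self, ratioBound_self]
    simp
  | succ n ih =>
    have h := step (j := j + 1) (by omega) (ih (j := j + 1) (by omega) (by omega))
    push_cast at h
    rw [add_assoc (j : ℝ), one_add_one_eq_two] at h
    exact h.le

theorem boros_moll_c_div_u_bounds (m i : ℕ) (hm : 2 ≤ m) (hi : 1 ≤ i) (hi' : i ≤ m - 1) :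
    ((m : ℝ) + i) / ((m : ℝ) + i + 1) <
        (d m i ^ 2 / (d m (i - 1) * d m (i + 1))) /
          ((1 + 1 / (i : ℝ)) * (1 + 1 / ((m : ℝ) - i))) ∧
      (d m i ^ 2 / (d m (i - 1) * d m (i + 1))) /
          ((1 + 1 / (i : ℝ)) * (1 + 1 / ((m : ℝ) - i))) < 1 := by
  have him : i < m := by omega
  have hrec : ((m : ℝ) - i + 1) * (m + i) * d m (i - 1) =
      i * ((2 * m + 1) * d m i - (i + 1) * d m (i + 1)) := by
    obtain ⟨j, rfl⟩ : ∃ j, i = j + 1 := ⟨i - 1, by omega⟩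
    have := d_recurrence m j
    rw [show j + 1 - 1 = j by rfl, show j + 1 + 1 = j + 2 by rfl]
    push_cast
    linear_combination this
  have hx := d_pos (show i - 1 ≤ m by omega)
  have hy := d_pos him.le
  have hz := d_pos (show i + 1 ≤ m by omega)
  have hupper := succ_mul_d_succ_lt him
  have hlower := ratioBound_mul_lt him
  have hroot := ratioBound_mul m i
  have hle := ratioBound_le him.le
  have hi0 : (0 : ℝ) < i := by exact_mod_cast hi
  have hmi : (0 : ℝ) < m - i := by rw [sub_pos]; exact_mod_cast him
  generalize d m (i - 1) = x at *
  generalize d m i = y at *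
  generalize d m (i + 1) = z at *
  generalize ratioBound m i = f at *
  generalize (i : ℝ) = i at *
  generalize (m : ℝ) = m at *
  have hm0 : 0 < m := by linarith
  have heq : y ^ 2 / (x * z) / ((1 + 1 / i) * (1 + 1 / (m - i))) =
      (y ^ 2 * (i * (m - i))) / (x * z * ((i + 1) * (m - i + 1))) := by
    field_simp
  rw [heq]
  have hden : 0 < x * z * ((i + 1) * (m - i + 1)) := by positivity
  have hprod : (m + i) * (x * z * ((i + 1) * (m - i + 1))) =
      i * (((i + 1) * z) * ((2 * m + 1) * y - (i + 1) * z)) := by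
    linear_combination (i + 1) * z * hrec
  constructor
  · rw [div_lt_div_iff₀ (by positivity) hden, hprod]
    have : 0 < ((m - i) * y - (i + 1) * z) * ((m + i + 1) * y - (i + 1) * z) :=
      mul_pos (by linarith) (by nlinarith)
    linear_combination i * this
  · rw [div_lt_one hden]
    refine lt_of_mul_lt_mul_left ?_ (show 0 ≤ m + i by positivity)
    rw [hprod]
    have : 0 < ((i + 1) * z - f * y) * ((2 * m + 1 - f) * y - (i + 1) * z) :=
      mul_pos (by linarith) (by nlinarith)
    linear_combination i * this - i * y ^ 2 * hroot
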